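/- Let A ∈ ℝ^{n×n}, B ∈ ℝ^{n×p}, K ∈ ℝ^{p×n}, set A_cl = A − B K, assumed non-singular. Let d ∈ ℝ^n, U = {u ∈ ℝ^p : G u ≤ h}, U' = {u ∈ ℝ^p : G' u ≤ h'}, and define Ũ = {u ∈ ℝ^p : G(α + β u) ≤ h and G' u ≤ h'} with α = −K A_cl⁻¹ d and β = I_p + K A_cl⁻¹ B. If Ũ equals the convex hull of finitely many points w_1, …, w_r ∈ ℝ^p, then the closed-loop backward reachable set satisfies R_cl(d, U') = conv(A_cl⁻¹(d − B w_1), …, A_cl⁻¹(d − B w_r)). -/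

import Mathlib

/-- The affine map `u ↦ M (d - B u)`. -/
def Matrix.mulVecSubAffineMap {m n p : Type*} [Fintype n] [Fintype p]
    (M : Matrix m n ℝ) (B : Matrix n p ℝ) (d : n → ℝ) : (p → ℝ) →ᵃ[ℝ] (m → ℝ) :=
  M.mulVecLin.toAffineMap.comp (AffineMap.const ℝ (p → ℝ) d - B.mulVecLin.toAffineMap)

@[simp]
theorem Matrix.mulVecSubAffineMap_apply {m n p : Type*} [Fintype n] [Fintype p]
    (M : Matrix m n ℝ) (B : Matrix n p ℝ) (d : n → ℝ) (u : p → ℝ) :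
    M.mulVecSubAffineMap B d u = M.mulVec (d - B.mulVec u) :=
  rfl

theorem Matrix.eq_mulVec_add_iff {n R : Type*} [Fintype n] [DecidableEq n] [CommRing R]
    {M : Matrix n n R} (hM : IsUnit M.det) {d x v : n → R} :
    d = M.mulVec x + v ↔ M⁻¹.mulVec (d - v) = x := by
  rw [← sub_eq_iff_eq_add]
  constructor
  · intro hd
    rw [hd, Matrix.mulVec_mulVec, Matrix.nonsing_inv_mul _ hM, Matrix.one_mulVec]
  · rintro rfl
    rw [Matrix.mulVec_mulVec, Matrix.mul_nonsing_inv _ hM, Matrix.one_mulVec]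

theorem Matrix.neg_mulVec_mulVec_sub_add {n p R : Type*} [Fintype n] [Fintype p]
    [DecidableEq p] [CommRing R]
    (M : Matrix n n R) (B : Matrix n p R) (K : Matrix p n R) (d : n → R) (u : p → R) :
    -(K.mulVec (M.mulVec (d - B.mulVec u))) + u =
      -(K.mulVec (M.mulVec d)) + (1 + K * M * B).mulVec u := by
  simp only [Matrix.mulVec_sub, Matrix.add_mulVec, Matrix.one_mulVec, ← Matrix.mulVec_mulVec]
  abel

/-- With `A_cl = A - B K` non-singular, polyhedral `U = {u : G u ≤ h}`,
`U' = {u : G' u ≤ h'}`, and `Ũ = {u : G (α + β u) ≤ h ∧ G' u ≤ h'}` where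
`α = -K A_cl⁻¹ d` and `β = I_p + K A_cl⁻¹ B`: if `Ũ` equals the convex hull of finitely
many points `w 1, …, w r`, then
`R_cl(d, U') = conv(A_cl⁻¹ (d - B (w 1)), …, A_cl⁻¹ (d - B (w r)))`. -/
theorem closed_loop_backward_set_eq_convexHull
    (n p q q' r : ℕ) (A : Matrix (Fin n) (Fin n) ℝ) (B : Matrix (Fin n) (Fin p) ℝ)
    (K : Matrix (Fin p) (Fin n) ℝ)
    (hAcl : IsUnit (A - B * K).det)
    (d : Fin n → ℝ)
    (G : Matrix (Fin q) (Fin p) ℝ) (h : Fin q → ℝ)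
    (G' : Matrix (Fin q') (Fin p) ℝ) (h' : Fin q' → ℝ)
    (w : Fin r → (Fin p → ℝ))
    (hUtilde : {u : Fin p → ℝ |
        G.mulVec ((-(K.mulVec ((A - B * K)⁻¹.mulVec d)))
          + ((1 : Matrix (Fin p) (Fin p) ℝ) + K * (A - B * K)⁻¹ * B).mulVec u) ≤ h ∧
        G'.mulVec u ≤ h'} = convexHull ℝ (Set.range w)) :
    {x : Fin n → ℝ | ∃ u' ∈ {u : Fin p → ℝ | G'.mulVec u ≤ h'},
        d = (A - B * K).mulVec x + B.mulVec u' ∧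
        -(K.mulVec x) + u' ∈ {u : Fin p → ℝ | G.mulVec u ≤ h}} =
    convexHull ℝ (Set.range fun i => (A - B * K)⁻¹.mulVec (d - B.mulVec (w i))) := by
  have hrange : (Set.range fun i => (A - B * K)⁻¹.mulVec (d - B.mulVec (w i))) =
      (A - B * K)⁻¹.mulVecSubAffineMap B d '' Set.range w := by
    rw [← Set.range_comp]
    rfl
  rw [hrange, ← AffineMap.image_convexHull, ← hUtilde]
  ext x
  simp only [Set.mem_ofPred_eq, Set.mem_image, Matrix.mulVecSubAffineMap_apply,
    Matrix.eq_mulVec_add_iff hAcl, ← Matrix.neg_mulVec_mulVec_sub_add]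
  constructor
  · rintro ⟨u, hu, rfl, hx⟩
    exact ⟨u, ⟨hx, hu⟩, rfl⟩
  · rintro ⟨u, ⟨hx, hu⟩, rfl⟩
    exact ⟨u, hu, rfl, hx⟩
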